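/- arXiv:math/0308156 — 2 statements merged into one kernel-verified Lean document; each statement's English description precedes it below -/
import Mathlib

section
/- Let ϖ∨ be a minuscule fundamental coweight of Δ with fundamental weight ϖ, ϖ* := −w₀(ϖ), associated chamber automorphism σ ∈ Σ with linear part σ̄ = w₀w_i ∈ W, and let N be the order of σ (equivalently the smallest positive integer with Nϖ∨ in the coroot lattice). Then the path π_N := (σ̄^{−N}(ϖ*) ⋆ ⋯ ⋆ σ̄^{−2}(ϖ*) ⋆ σ̄^{−1}(ϖ*)) belongs to the N-fold concatenation B(ϖ*) ⋆ ⋯ ⋆ B(ϖ*), is dominant for the finite root system (⟨π_N(t), α_j∨⟩ ≥ 0 for all t and all j = 1,…,r), and has weight 0. -/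
/-
Background: reduced irreducible crystallographic root systems with a chosen base,
realized in a real inner product space.  Coweights are represented as vectors of the
same space via the `W`-invariant inner product (so the coroot of `a` is `2a/(a,a)`).
-/

open scoped RealInnerProductSpace Classical

noncomputable section

namespace Litt

variable {V : Type*} [NormedAddCommGroup V] [InnerProductSpace ℝ V]

/-- The coroot of a root vector, under the inner-product identification of `𝔥` with `𝔥*`. -/
def coroot (a : V) : V := (2 / ⟪a, a⟫) • a

/-- The pairing `⟨x, α∨⟩` of a weight `x` with the coroot of `a`. -/
def pairc (x a : V) : ℝ := ⟪x, coroot a⟫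

/-- The reflection `s_a (x) = x - ⟨x, a∨⟩ a`, as a linear map. -/
def sLin (a : V) : V →ₗ[ℝ] V :=
  LinearMap.id - ((innerₛₗ ℝ (coroot a)).smulRight a)

/-- A reduced irreducible crystallographic root system spanning `V`, together with a
chosen system of simple roots `α 0, …, α (r-1)`. -/
structure RootSystemBase (r : ℕ) (V : Type*) [NormedAddCommGroup V]
    [InnerProductSpace ℝ V] where
  roots : Set V
  α : Fin r → V
  finite : roots.Finite
  ne_zero : ∀ a ∈ roots, a ≠ 0
  span_top : Submodule.span ℝ roots = ⊤
  reduced : ∀ a ∈ roots, ∀ t : ℝ, t • a ∈ roots → t = 1 ∨ t = -1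
  reflect_mem : ∀ a ∈ roots, ∀ b ∈ roots, sLin a b ∈ roots
  cryst : ∀ a ∈ roots, ∀ b ∈ roots, ∃ n : ℤ, pairc b a = (n : ℝ)
  irred : ∀ S T : Set V, roots = S ∪ T → (∀ a ∈ S, ∀ b ∈ T, ⟪a, b⟫ = 0) →
    S = ∅ ∨ T = ∅
  simple_mem : ∀ i, α i ∈ roots
  simple_indep : LinearIndependent ℝ α
  pos_or_neg : ∀ a ∈ roots, (∃ c : Fin r → ℕ, a = ∑ i, (c i : ℝ) • α i) ∨
    (∃ c : Fin r → ℕ, a = -∑ i, (c i : ℝ) • α i)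

namespace RootSystemBase

variable {r : ℕ} (R : RootSystemBase r V)

/-- The positive roots determined by the base. -/
def pos : Set V := {a ∈ R.roots | ∃ c : Fin r → ℕ, a = ∑ i, (c i : ℝ) • R.α i}

/-- `w` is the fundamental weight at node `i`:  `⟨w, α_j∨⟩ = δ_ij`. -/
def IsFundWeight (i : Fin r) (w : V) : Prop :=
  ∀ j, pairc w (R.α j) = if j = i then 1 else 0

/-- `c` is (the image under `ν` of) the fundamental coweight at node `i`:
`⟨α_j, ϖ_i∨⟩ = δ_ij`, the pairing of a root with a coweight being realized by the
inner product. -/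
def IsFundCoweight (i : Fin r) (c : V) : Prop :=
  ∀ j, ⟪R.α j, c⟫ = if j = i then 1 else 0

/-- A coweight is minuscule if it pairs to `0` or `1` with every positive root. -/
def IsMinusculeCoweight (c : V) : Prop :=
  ∀ a ∈ R.pos, ⟪a, c⟫ = 0 ∨ ⟪a, c⟫ = 1

/-- The Weyl group: the subgroup of `GL(V)` generated by the simple reflections. -/
def weyl : Subgroup (V ≃ₗ[ℝ] V) :=
  Subgroup.closure {g | ∃ i : Fin r, ∀ x, g x = sLin (R.α i) x}

/-- The orbit `W·λ` of a weight under the Weyl group. -/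
def orbit (lam : V) : Set V := {x | ∃ g ∈ R.weyl, x = g lam}

/-- `w` is the longest element `w₀` of the Weyl group: it sends every positive root to a
negative root. -/
def IsLongest (w : V ≃ₗ[ℝ] V) : Prop :=
  w ∈ R.weyl ∧ ∀ a ∈ R.pos, -(w a) ∈ R.pos

/-- `w` is the longest element of the parabolic subgroup `Stab_W(ϖ)`: it stabilizes `ϖ`
and sends every positive root pairing to `0` with `ϖ` to a negative root. -/
def IsLongestPar (ϖ : V) (w : V ≃ₗ[ℝ] V) : Prop :=
  w ∈ R.weyl ∧ w ϖ = ϖ ∧ ∀ a ∈ R.pos, pairc ϖ a = 0 → -(w a) ∈ R.pos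

/-- `θ` is the highest root: for every root `a`, `θ - a` is a nonnegative combination of
the simple roots. -/
def IsHighestRoot (θ : V) : Prop :=
  θ ∈ R.pos ∧ ∀ a ∈ R.roots, ∃ c : Fin r → ℕ, θ - a = ∑ i, (c i : ℝ) • R.α i

/-- The coroot lattice, as a `ℤ`-submodule of `V`. -/
def corootLattice : Submodule ℤ V := Submodule.span ℤ (coroot '' R.roots)

end RootSystemBase

end Litt
namespace Litt

/-! ### Littelmann paths as lists of steps

A piecewise-linear path `π = (v₁ ⋆ ⋯ ⋆ v_k)` starting at `0` is recorded by its list of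
steps `[v₁, …, v_k]`.  Two step lists describe the same path up to reparametrization
iff they have the same `normalize`d form (zero steps removed, consecutive positively
proportional steps merged). -/

variable {M : Type*} [AddCommGroup M] [Module ℝ M]

/-- Prepend one step to a normalized list of steps, merging it with the head if the two
are positively proportional and dropping it if it is zero. -/
def consStep (v : M) : List M → List M
  | [] => if v = 0 then [] else [v]
  | w :: L =>
      if v = 0 then w :: L
      else if ∃ c : ℝ, 0 < c ∧ w = c • v then (v + w) :: L else v :: w :: L

/-- The normal form of a step list: two step lists represent the same piecewise-linear
path up to reparametrization iff their normal forms coincide. -/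
def normalize : List M → List M := List.foldr consStep []

/-- The concatenation `S₁ ⋆ S₂` of two sets of paths. -/
def starSet (S₁ S₂ : Set (List M)) : Set (List M) := Set.image2 (· ++ ·) S₁ S₂

/-- The concatenation `S₁ ⋆ ⋯ ⋆ S_m` of a list of sets of paths. -/
def catSets : List (Set (List M)) → Set (List M)
  | [] => {([] : List M)}
  | S :: Ss => starSet S (catSets Ss)

/-- The data of a root operator in the sense of Littelmann: a root vector `vec` (a root
of `𝔤`, or a real root of `𝔤̂` modulo `δ`) together with the linear functional `cov`
given by pairing with its coroot. -/
structure RootOp (M : Type*) [AddCommGroup M] [Module ℝ M] where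
  vec : M
  cov : M →ₗ[ℝ] ℝ

namespace RootOp

variable (d : RootOp M)

/-- The associated reflection `s_i x = x - ⟨x, α_i∨⟩ α_i`. -/
def s (x : M) : M := x - d.cov x • d.vec

/-- The value `h_i` of the height function at the `j`-th corner of the path;
since the height function is affine on each step, its extrema on the path are
attained at corners. -/
def hgt (L : List M) (j : ℕ) : ℝ := d.cov ((L.take j).sum)

/-- The minimum `M` of the height function `h_i` along the path. -/
def minH (L : List M) : ℝ := sInf ((d.hgt L) '' {j | j ≤ L.length})

/-- The corner at which the height function attains its minimum for the last time. -/
def lastMin (L : List M) : ℕ := sSup {j | j ≤ L.length ∧ d.hgt L j = d.minH L}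

/-- `f_i` is defined on `π` iff after the last minimum of the height function the height
rises to `M + 1`. -/
def fDef (L : List M) : Prop :=
  ∃ j ≤ L.length, d.lastMin L < j ∧ d.minH L + 1 ≤ d.hgt L j

/-- The first corner after the last minimum at which the height has reached `M + 1`
(the height first reaches `M + 1` within the step leading to this corner). -/
def fIdx (L : List M) : ℕ :=
  sInf {j | d.lastMin L < j ∧ d.minH L + 1 ≤ d.hgt L j}

/-- The lowering root operator `f_i` on paths (meaningful when `fDef` holds): writing
`π = π₁ ⋆ π₂ ⋆ π₃` where `π₂` is the last subpath on which `M ≤ h_i ≤ M + 1` — it runs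
from the last minimum of the height function to the first subsequent point where the
height reaches `M + 1`, splitting the step through which the latter occurs — one sets
`f_i π := π₁ ⋆ s_i π₂ ⋆ π₃`. -/
def fList (L : List M) : List M :=
  let j1 := d.lastMin L
  let j2 := d.fIdx L
  let v := L.getD (j2 - 1) 0
  let c := (d.minH L + 1 - d.hgt L (j2 - 1)) / (d.hgt L j2 - d.hgt L (j2 - 1))
  L.take j1 ++ ((((L.drop j1).take (j2 - 1 - j1)).map d.s) ++ [d.s (c • v)])
    ++ ([(1 - c) • v] ++ L.drop j2)

/-- The root operator `f_i` as a relation between paths. -/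
def frel (L L' : List M) : Prop := d.fDef L ∧ L' = d.fList L

/-- The root operator `f_i` as a relation between paths up to reparametrization. -/
def frelC (L L' : List M) : Prop :=
  ∃ L₁, normalize L₁ = normalize L ∧ d.fDef L₁ ∧ normalize L' = normalize (d.fList L₁)

end RootOp

/-- The closure of a set of paths under a single root operator `f_i`:
`{f_i^k π ∣ π ∈ S, k ≥ 0}`. -/
def fClos (d : RootOp M) (S : Set (List M)) : Set (List M) :=
  {L' | ∃ L ∈ S, Relation.ReflTransGen d.frel L L'}

/-- The set of paths generated from a set of paths by the root operators `f_i`. -/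
def genF {ι : Type*} (D : ι → RootOp M) (S : Set (List M)) : Set (List M) :=
  {L' | ∃ L ∈ S, Relation.ReflTransGen (fun x y => ∃ i, (D i).frel x y) L L'}

/-- The set of paths generated from a set of paths by the root operators `f_i` and
their inverses `e_i` (recall `e_i π = π' ↔ f_i π' = π`). -/
def genFE {ι : Type*} (D : ι → RootOp M) (S : Set (List M)) : Set (List M) :=
  {L' | ∃ L ∈ S,
    Relation.ReflTransGen (fun x y => ∃ i, (D i).frel x y ∨ (D i).frel y x) L L'}

/-- The Demazure operator `B̂_z` attached to the word `w = [i₁, …, i_m]` (a reduced word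
for `z`):  `B̂_z(S) = {f_{i₁}^{k₁} ⋯ f_{i_m}^{k_m} π ∣ π ∈ S, k₁, …, k_m ≥ 0}`. -/
def demazureWord {ι : Type*} (D : ι → RootOp M) : List ι → Set (List M) → Set (List M)
  | [] => id
  | i :: w => fun S => fClos (D i) (demazureWord D w S)

end Litt
namespace Litt

variable {V : Type*} [NormedAddCommGroup V] [InnerProductSpace ℝ V]

/-- The root operators `f_1, …, f_r` of the finite algebra `𝔤`, acting on paths in the
finite weight space. -/
def finOp {r : ℕ} (R : RootSystemBase r V) (i : Fin r) : RootOp V :=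
  ⟨R.α i, innerₛₗ ℝ (coroot (R.α i))⟩

/-- The Littelmann crystal `B(μ)`, generated from the straight-line path `(μ)` by the
root operators `f_1, …, f_r`. -/
def finCrystalV {r : ℕ} (R : RootSystemBase r V) (μ : V) : Set (List V) :=
  genF (finOp R) {[μ]}

section Paths

variable {M : Type*} [AddCommGroup M] [Module ℝ M]

lemma consStep_zero (L : List M) : consStep 0 L = L := by
  cases L <;> simp [consStep]

lemma consStep_smul_consStep_smul (τ : M) {a b : ℝ} (ha : 0 ≤ a) (hb : 0 ≤ b) (L : List M) :
    consStep (a • τ) (consStep (b • τ) L) = consStep ((a + b) • τ) L := by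
  rcases eq_or_ne τ 0 with rfl | hτ
  · simp [consStep_zero]
  rcases ha.eq_or_lt with rfl | ha
  · simp [consStep_zero]
  rcases hb.eq_or_lt with rfl | hb
  · simp [consStep_zero]
  have ha' : a • τ ≠ 0 := smul_ne_zero ha.ne' hτ
  have hb' : b • τ ≠ 0 := smul_ne_zero hb.ne' hτ
  have hab : (a + b) • τ ≠ 0 := smul_ne_zero (by positivity) hτ
  have key : ∀ x y : ℝ, 0 < x → 0 < y → y • τ = (y / x) • x • τ := fun x y hx _ => by
    rw [smul_smul, div_mul_cancel₀ _ hx.ne']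
  cases L with
  | nil =>
    have h : ∃ c : ℝ, 0 < c ∧ b • τ = c • a • τ := ⟨b / a, by positivity, key a b ha hb⟩
    rw [add_smul] at hab ⊢
    simp only [consStep, ha', hb', hab, if_false, if_pos h]
  | cons w L =>
    by_cases hw : ∃ c : ℝ, 0 < c ∧ w = c • τ
    · obtain ⟨c, hc, rfl⟩ := hw
      have h1 : ∃ e : ℝ, 0 < e ∧ c • τ = e • b • τ := ⟨c / b, by positivity, key b c hb hc⟩
      have h2 : ∃ e : ℝ, 0 < e ∧ c • τ = e • (a + b) • τ :=
        ⟨c / (a + b), by positivity, key (a + b) c (by positivity) hc⟩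
      have h3 : ∃ e : ℝ, 0 < e ∧ b • τ + c • τ = e • a • τ :=
        ⟨(b + c) / a, by positivity, by rw [← key a (b + c) ha (by positivity), add_smul]⟩
      rw [add_smul] at hab h2 ⊢
      simp only [consStep, ha', hb', hab, if_false, if_pos h1, if_pos h2, if_pos h3, add_assoc]
    · have h1 : ∀ x : ℝ, 0 < x → ¬ ∃ e : ℝ, 0 < e ∧ w = e • x • τ := by
        rintro x hx ⟨e, he, rfl⟩
        exact hw ⟨e * x, by positivity, by rw [smul_smul]⟩
      have h3 : ∃ e : ℝ, 0 < e ∧ b • τ = e • a • τ := ⟨b / a, by positivity, key a b ha hb⟩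
      have h2 := h1 (a + b) (by positivity)
      rw [add_smul] at hab h2 ⊢
      simp only [consStep, ha', hb', hab, if_false, if_neg (h1 b hb), if_neg h2, if_pos h3]

/-- Straight steps in the direction `τ` normalize to a single step. -/
lemma foldr_consStep_map_smul (τ : M) (C : List ℝ) (hC : ∀ x ∈ C, 0 ≤ x) (L : List M) :
    List.foldr consStep L (C.map (· • τ)) = consStep (C.sum • τ) L := by
  induction C with
  | nil => simp [consStep_zero]
  | cons a C ih =>
    have hC' : ∀ x ∈ C, 0 ≤ x := fun x hx => hC x (List.mem_cons_of_mem _ hx)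
    rw [List.map_cons, List.foldr_cons, ih hC', List.sum_cons,
      consStep_smul_consStep_smul τ (hC a List.mem_cons_self) (List.sum_nonneg hC')]

/-- If every step of `l` is represented by a subdivided straight path in `S`, then the path with
steps `l` is represented in the corresponding concatenation power of `S`. -/
lemma exists_mem_catSets_normalize_eq (S : Set (List M)) (l : List M)
    (h : ∀ v ∈ l, ∃ C : List ℝ, (∀ x ∈ C, 0 ≤ x) ∧ C.sum = 1 ∧ C.map (· • v) ∈ S) :
    ∃ L ∈ catSets (List.replicate l.length S), normalize L = normalize l := by
  induction l with
  | nil => exact ⟨[], rfl, rfl⟩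
  | cons v l ih =>
    obtain ⟨L, hL, hn⟩ := ih fun u hu => h u (List.mem_cons_of_mem _ hu)
    obtain ⟨C, hC, hs, hm⟩ := h v List.mem_cons_self
    refine ⟨C.map (· • v) ++ L, ⟨_, hm, L, hL, rfl⟩, ?_⟩
    have : normalize (v :: l) = consStep v (normalize l) := rfl
    rw [this, ← hn, normalize, List.foldr_append, foldr_consStep_map_smul v C hC, hs, one_smul]

lemma sum_map_smul (τ : M) (C : List ℝ) : (C.map (· • τ)).sum = C.sum • τ := by
  induction C with
  | nil => simp
  | cons a C ih => simp [ih, add_smul]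

lemma exists_eq_append_of_sum_ge {t : ℝ} (ht : 0 < t) (Q : List ℝ) (h : t ≤ Q.sum) :
    ∃ Q₁ q Q₂, Q = Q₁ ++ q :: Q₂ ∧ (∀ m, (Q₁.take m).sum < t) ∧ t ≤ Q₁.sum + q := by
  induction Q generalizing t with
  | nil => simp at h; linarith
  | cons a Q ih =>
    by_cases ha : t ≤ a
    · exact ⟨[], a, Q, rfl, by simpa using ht, by simpa using ha⟩
    · push Not at ha
      obtain ⟨Q₁, q, Q₂, rfl, h1, h2⟩ := ih (t := t - a) (by linarith) (by
        simp only [List.sum_cons] at h; linarith)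
      refine ⟨a :: Q₁, q, Q₂, rfl, ?_, ?_⟩
      · rintro (_ | m)
        · simpa using ht
        · have := h1 m
          simp only [List.take_succ_cons, List.sum_cons]; linarith
      · simp only [List.sum_cons]; linarith

lemma exists_eq_replicate_zero_append (Q : List ℝ) (hQ : ∀ x ∈ Q, 0 ≤ x) (h : 0 < Q.sum) :
    ∃ m a Q', Q = List.replicate m 0 ++ a :: Q' ∧ 0 < a := by
  induction Q with
  | nil => simp at h
  | cons a Q ih =>
    rcases (hQ a List.mem_cons_self).eq_or_lt with rfl | ha
    · obtain ⟨m, a, Q', rfl, ha⟩ :=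
        ih (fun x hx => hQ x (List.mem_cons_of_mem _ hx)) (by simpa using h)
      exact ⟨m + 1, a, Q', rfl, ha⟩
    · exact ⟨0, a, Q, rfl, ha⟩

namespace RootOp

variable (d : RootOp M)

lemma s_smul (x : ℝ) (v : M) : d.s (x • v) = x • d.s v := by
  simp [s, smul_sub, smul_smul]

/-- The path with steps in direction `s τ` followed by steps in direction `τ`, with the given
lists of lengths. -/
def bent (τ : M) (P Q : List ℝ) : List M :=
  P.map (· • d.s τ) ++ Q.map (· • τ)

variable {d}

lemma cov_s (hd : d.cov d.vec = 2) (τ : M) : d.cov (d.s τ) = -d.cov τ := by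
  simp [s, hd]; ring

lemma hgt_bent_left (hd : d.cov d.vec = 2) (τ : M) (P Q : List ℝ) {j : ℕ} (hj : j ≤ P.length) :
    d.hgt (d.bent τ P Q) j = -(d.cov τ * (P.take j).sum) := by
  rw [hgt, bent, List.take_append_of_le_length (by simpa using hj), ← List.map_take,
    sum_map_smul, map_smul, cov_s hd, smul_eq_mul]
  ring

lemma hgt_bent_right (hd : d.cov d.vec = 2) (τ : M) (P Q : List ℝ) (j : ℕ) :
    d.hgt (d.bent τ P Q) (P.length + j) = d.cov τ * (Q.take j).sum - d.cov τ * P.sum := by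
  have : List.take (P.length + j) (d.bent τ P Q)
      = P.map (· • d.s τ) ++ (Q.take j).map (· • τ) := by
    have h : P.length = (P.map (· • d.s τ)).length := by simp
    rw [bent, h, List.take_length_add_append, List.map_take]
  rw [hgt, this, List.sum_append, sum_map_smul, sum_map_smul, map_add, map_smul, map_smul,
    cov_s hd, smul_eq_mul, smul_eq_mul]
  ring

/-- Explicit value of the root operator on a path bent along `τ`. -/
lemma frel_bent_aux (hd : d.cov d.vec = 2) {τ : M} (hτ : 0 < d.cov τ) (P Q₁ Q₂ : List ℝ) (q : ℝ)
    (hP : ∀ x ∈ P, 0 ≤ x) (hQ : ∀ x ∈ Q₁ ++ q :: Q₂, 0 ≤ x)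
    (hpos : ∀ m, 0 < m → 0 < ((Q₁ ++ q :: Q₂).take m).sum)
    (hlt : ∀ m, d.cov τ * (Q₁.take m).sum < 1) (hge : 1 ≤ d.cov τ * (Q₁.sum + q)) :
    d.frel (d.bent τ P (Q₁ ++ q :: Q₂))
      (d.bent τ (P ++ Q₁ ++ [(1 - d.cov τ * Q₁.sum) / (d.cov τ)])
        ((q - (1 - d.cov τ * Q₁.sum) / (d.cov τ)) :: Q₂)) := by
  set n := d.cov τ with hn
  set Q := Q₁ ++ q :: Q₂ with hQdef
  set L := d.bent τ P Q with hL
  have hlen : L.length = P.length + Q.length := by simp [hL, bent]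
  have hleft : ∀ j ≤ P.length, d.hgt L j = -(n * (P.take j).sum) :=
    fun j hj => hgt_bent_left hd τ P Q hj
  have hright : ∀ j, d.hgt L (P.length + j) = n * (Q.take j).sum - n * P.sum :=
    hgt_bent_right hd τ P Q
  have hP0 : d.hgt L P.length = -(n * P.sum) := by simpa using hright 0
  have hPle : ∀ j, (P.take j).sum ≤ P.sum := fun j =>
    (List.take_sublist j P).sum_le_sum hP
  have hlow : ∀ j, -(n * P.sum) ≤ d.hgt L j := by
    intro j
    rcases le_total j P.length with hj | hj
    · rw [hleft j hj]
      have := mul_le_mul_of_nonneg_left (hPle j) hτ.le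
      linarith
    · obtain ⟨m, rfl⟩ := Nat.exists_eq_add_of_le hj
      rw [hright]
      have : 0 ≤ (Q.take m).sum := List.sum_nonneg fun x hx => hQ x (List.mem_of_mem_take hx)
      have := mul_nonneg hτ.le this
      linarith
  have hmin : d.minH L = -(n * P.sum) :=
    IsLeast.csInf_eq ⟨⟨P.length, by simp [hlen], hP0⟩, by rintro _ ⟨j, -, rfl⟩; exact hlow j⟩
  have hgt' : ∀ m, 0 < m → d.minH L < d.hgt L (P.length + m) := fun m hm => by
    rw [hright, hmin]
    have := mul_pos hτ (hpos m hm)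
    linarith
  have hlast : d.lastMin L = P.length := by
    refine IsGreatest.csSup_eq ⟨⟨by simp [hlen], by rw [hP0, hmin]⟩, ?_⟩
    rintro j ⟨-, hj⟩
    by_contra! hlt
    obtain ⟨m, rfl⟩ := Nat.exists_eq_add_of_lt hlt
    have := hgt' (m + 1) (Nat.succ_pos m)
    rw [← add_assoc, hj] at this
    exact this.false
  have hQtake : Q.take (Q₁.length + 1) = Q₁ ++ [q] := by simp [hQdef, List.take_append]
  have hQtake1 : ∀ m ≤ Q₁.length, Q.take m = Q₁.take m := fun m hm => by
    simp [hQdef, List.take_append_of_le_length hm]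
  have hreach : d.minH L + 1 ≤ d.hgt L (P.length + (Q₁.length + 1)) := by
    rw [hright, hmin, hQtake, List.sum_append, List.sum_singleton]; linarith
  have hidx : d.fIdx L = P.length + (Q₁.length + 1) := by
    refine IsLeast.csInf_eq ⟨⟨by rw [hlast]; omega, hreach⟩, ?_⟩
    rintro j ⟨hj1, hj2⟩
    by_contra! hlt'
    rw [hlast] at hj1
    obtain ⟨m, rfl⟩ := Nat.exists_eq_add_of_le hj1.le
    rw [hright, hmin, hQtake1 m (by omega)] at hj2
    have := hlt m
    linarith
  refine ⟨⟨P.length + (Q₁.length + 1), by simp [hlen, hQdef], by rw [hlast]; omega,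
    hreach⟩, ?_⟩
  have hh1 : d.hgt L (P.length + Q₁.length) = n * Q₁.sum - n * P.sum := by
    rw [hright, hQtake1 _ le_rfl, List.take_length]
  have hh2 : d.hgt L (P.length + (Q₁.length + 1)) = n * (Q₁.sum + q) - n * P.sum := by
    rw [hright, hQtake, List.sum_append, List.sum_singleton]
  have hq : 0 < q := by
    have h1 := hlt Q₁.length
    rw [List.take_length] at h1
    by_contra! h
    have := mul_nonneg hτ.le (neg_nonneg.2 h)
    nlinarith
  have hv : L.getD (P.length + Q₁.length) 0 = q • τ := by
    have : L = (P.map (· • d.s τ) ++ Q₁.map (· • τ)) ++ (q • τ) :: Q₂.map (· • τ) := by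
      simp [hL, bent, hQdef]
    rw [this, List.getD_append_right _ _ _ _ (by simp)]
    simp
  have hc : (-(n * P.sum) + 1 - (n * Q₁.sum - n * P.sum)) /
      (n * (Q₁.sum + q) - n * P.sum - (n * Q₁.sum - n * P.sum)) * q = (1 - n * Q₁.sum) / n := by
    have : n * (Q₁.sum + q) - n * P.sum - (n * Q₁.sum - n * P.sum) = n * q := by ring
    rw [this]
    field_simp
    ring
  have e1 : P.length + (Q₁.length + 1) - 1 = P.length + Q₁.length := by omega
  have e2 : P.length + (Q₁.length + 1) - 1 - P.length = Q₁.length := by omega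
  have t1 : L.take P.length = P.map (· • d.s τ) := by
    simp [hL, bent]
  have t2 : (L.drop P.length).take Q₁.length = Q₁.map (· • τ) := by
    simp [hL, bent, hQdef]
  have t3 : L.drop (P.length + (Q₁.length + 1)) = Q₂.map (· • τ) := by
    rw [← List.drop_drop]
    simp [hL, bent, hQdef, List.drop_append]
  simp only [fList, hlast, hidx, e1, hmin, hh1, hh2, hv, t1, t3, s_smul, smul_smul, hc, sub_mul,
    one_mul]
  rw [Nat.add_sub_cancel_left, t2, List.map_map]
  simp [bent, Function.comp_def, s_smul]

/-- A root operator is defined on a bent path that still rises by at least `1`, and lowers it to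
a path of the same shape. -/
lemma exists_frel_bent (hd : d.cov d.vec = 2) {τ : M} (hτ : 0 < d.cov τ) (P Q : List ℝ)
    (hP : ∀ x ∈ P, 0 ≤ x) (hQ : ∀ x ∈ Q, 0 ≤ x) (h1 : 1 ≤ d.cov τ * Q.sum) :
    ∃ P' Q' : List ℝ, (∀ x ∈ P', 0 ≤ x) ∧ (∀ x ∈ Q', 0 ≤ x) ∧
      P'.sum + Q'.sum = P.sum + Q.sum ∧ d.cov τ * P'.sum = d.cov τ * P.sum + 1 ∧
      d.frel (d.bent τ P Q) (d.bent τ P' Q') := by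
  have hQs : 0 < Q.sum := by
    by_contra! h
    nlinarith
  obtain ⟨m, a, Q', rfl, ha⟩ := exists_eq_replicate_zero_append Q hQ hQs
  have hQ' : ∀ x ∈ a :: Q', 0 ≤ x := fun x hx => hQ x (List.mem_append_right _ hx)
  have hsum : (List.replicate m (0 : ℝ) ++ a :: Q').sum = (a :: Q').sum := by simp
  rw [hsum] at h1
  have hbent : d.bent τ P (List.replicate m 0 ++ a :: Q')
      = d.bent τ (P ++ List.replicate m 0) (a :: Q') := by
    simp [bent]
  obtain ⟨Q₁, q, Q₂, hdec, hlt, hge⟩ := exists_eq_append_of_sum_ge (t := 1 / d.cov τ)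
    (by positivity) (a :: Q') (by rw [div_le_iff₀ hτ]; linarith)
  have hpos : ∀ m, 0 < m → 0 < ((a :: Q').take m).sum := by
    rintro (_ | m) hm
    · exact absurd hm (lt_irrefl _)
    · rw [List.take_succ_cons, List.sum_cons]
      have : 0 ≤ (Q'.take m).sum := List.sum_nonneg fun x hx =>
        hQ' x (List.mem_cons_of_mem _ (List.mem_of_mem_take hx))
      linarith
  have hP₀ : ∀ x ∈ P ++ List.replicate m 0, 0 ≤ x := by
    intro x hx
    rcases List.mem_append.1 hx with hx | hx
    · exact hP x hx
    · exact (List.eq_of_mem_replicate hx).ge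
  have hlt' : ∀ m, d.cov τ * (Q₁.take m).sum < 1 := fun m => by
    have := (lt_div_iff₀ hτ).1 (hlt m)
    linarith
  have hge' : 1 ≤ d.cov τ * (Q₁.sum + q) := by
    have := (div_le_iff₀ hτ).1 hge
    linarith
  have hltl := hlt' Q₁.length
  rw [List.take_length] at hltl
  rw [hdec] at hpos hQ'
  have hfrel := frel_bent_aux hd hτ _ Q₁ Q₂ q hP₀ hQ' hpos hlt' hge'
  rw [← hdec, ← hbent] at hfrel
  refine ⟨_, _, ?_, ?_, ?_, ?_, hfrel⟩
  · intro x hx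
    rcases List.mem_append.1 hx with hx | hx
    · rcases List.mem_append.1 hx with hx | hx
      · exact hP₀ x hx
      · exact hQ' x (List.mem_append_left _ hx)
    · rw [List.mem_singleton.1 hx]
      exact div_nonneg (by linarith) hτ.le
  · intro x hx
    rcases List.mem_cons.1 hx with rfl | hx
    · rw [sub_nonneg, div_le_iff₀ hτ]; linarith
    · exact hQ' x (List.mem_append_right _ (List.mem_cons_of_mem _ hx))
  · rw [hsum, hdec]
    simp
    ring
  · simp only [List.sum_append, List.sum_replicate, List.sum_singleton]
    field_simp
    ring

/-- Iterating the root operator reflects a subdivided straight path. -/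
lemma exists_reflTransGen_frel_map_s (hd : d.cov d.vec = 2) {τ : M} (n : ℕ) (hn : d.cov τ = n)
    (C : List ℝ) (hC : ∀ x ∈ C, 0 ≤ x) (hs : C.sum = 1) :
    ∃ C' : List ℝ, (∀ x ∈ C', 0 ≤ x) ∧ C'.sum = 1 ∧
      Relation.ReflTransGen d.frel (C.map (· • τ)) (C'.map (· • d.s τ)) := by
  rcases Nat.eq_zero_or_pos n with rfl | hn0
  · refine ⟨C, hC, hs, ?_⟩
    have : d.s τ = τ := by simp [s, hn]
    rw [this]
  have hτ : 0 < d.cov τ := by rw [hn]; exact_mod_cast hn0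
  have key : ∀ k ≤ n, ∃ P Q : List ℝ, (∀ x ∈ P, 0 ≤ x) ∧ (∀ x ∈ Q, 0 ≤ x) ∧
      P.sum + Q.sum = 1 ∧ d.cov τ * P.sum = k ∧
      Relation.ReflTransGen d.frel (C.map (· • τ)) (d.bent τ P Q) := by
    intro k
    induction k with
    | zero =>
      intro _
      exact ⟨[], C, by simp, hC, by simpa using hs, by simp, Relation.ReflTransGen.refl⟩
    | succ k ih =>
      intro hk
      obtain ⟨P, Q, hP, hQ, hPQ, hPk, hrel⟩ := ih (by omega)
      have hk' : (k : ℝ) + 1 ≤ n := by exact_mod_cast hk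
      have h1 : 1 ≤ d.cov τ * Q.sum := by
        have : Q.sum = 1 - P.sum := by linarith
        rw [this, mul_sub, hPk, hn]; linarith
      obtain ⟨P', Q', hP', hQ', hs', hP1, hstep⟩ := exists_frel_bent hd hτ P Q hP hQ h1
      exact ⟨P', Q', hP', hQ', by rw [hs', hPQ], by rw [hP1, hPk]; push_cast; ring,
        hrel.tail hstep⟩
  obtain ⟨P, Q, hP, hQ, hPQ, hPn, hrel⟩ := key n le_rfl
  have hP1 : P.sum = 1 := by
    rw [← hn] at hPn
    exact (mul_eq_left₀ hτ.ne').1 hPn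
  have hQz : ∀ x ∈ Q, x = 0 := by
    have hQ0 : Q.sum = 0 := by linarith
    intro x hx
    exact le_antisymm (hQ0 ▸ List.single_le_sum hQ x hx) (hQ x hx)
  refine ⟨P ++ Q, ?_, by rw [List.sum_append, hPQ], ?_⟩
  · intro x hx
    rcases List.mem_append.1 hx with hx | hx
    exacts [hP x hx, hQ x hx]
  · have : d.bent τ P Q = (P ++ Q).map (· • d.s τ) := by
      rw [bent, List.map_append]
      congr 1
      refine List.map_congr_left fun x hx => ?_
      simp [hQz x hx]
    rwa [this] at hrel

end RootOp

end Paths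

lemma sLin_apply (a x : V) : sLin a x = x - ⟪coroot a, x⟫ • a := by
  simp [sLin]

lemma inner_coroot_left (a x : V) : ⟪coroot a, x⟫ = 2 / ⟪a, a⟫ * ⟪a, x⟫ := by
  rw [coroot, real_inner_smul_left]

lemma inner_coroot_self {a : V} (ha : a ≠ 0) : ⟪coroot a, a⟫ = 2 := by
  rw [inner_coroot_left]
  exact div_mul_cancel₀ _ (inner_self_ne_zero.2 ha)

lemma inner_sLin_left (a x y : V) : ⟪sLin a x, y⟫ = ⟪x, sLin a y⟫ := by
  simp only [sLin_apply, inner_sub_left, inner_sub_right, real_inner_smul_left,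
    real_inner_smul_right, inner_coroot_left, real_inner_comm a]
  ring

lemma sLin_sLin {a : V} (ha : a ≠ 0) (x : V) : sLin a (sLin a x) = x := by
  simp only [sLin_apply, inner_sub_right, real_inner_smul_right, inner_coroot_self ha]
  module

lemma sLin_self {a : V} (ha : a ≠ 0) : sLin a a = -a := by
  rw [sLin_apply, inner_coroot_self ha]
  module

lemma inner_sLin_sLin {a : V} (ha : a ≠ 0) (x y : V) : ⟪sLin a x, sLin a y⟫ = ⟪x, y⟫ := by
  rw [inner_sLin_left, sLin_sLin ha]

lemma sLin_sLin_conj {a : V} (ha : a ≠ 0) (b y : V) :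
    sLin (sLin a b) (sLin a y) = sLin a (sLin b y) := by
  rw [sLin_apply (sLin a b), inner_coroot_left, inner_sLin_sLin ha, inner_sLin_sLin ha,
    ← inner_coroot_left, sLin_apply b, map_sub, map_smul]

namespace RootSystemBase

variable {r : ℕ} (R : RootSystemBase r V)

lemma simple_ne_zero (i : Fin r) : R.α i ≠ 0 := R.ne_zero _ (R.simple_mem i)

variable {R}

lemma neg_mem_roots {a : V} (ha : a ∈ R.roots) : -a ∈ R.roots := by
  have := R.reflect_mem a ha a ha
  rwa [sLin_self (R.ne_zero a ha)] at this

lemma mem_pos_or_neg_mem_pos {a : V} (ha : a ∈ R.roots) : a ∈ R.pos ∨ -a ∈ R.pos := by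
  rcases R.pos_or_neg a ha with h | ⟨c, h⟩
  · exact Or.inl ⟨ha, h⟩
  · exact Or.inr ⟨neg_mem_roots ha, c, by rw [h, neg_neg]⟩

lemma simple_mem_pos (i : Fin r) : R.α i ∈ R.pos :=
  ⟨R.simple_mem i, Pi.single i 1, by simp [Pi.single_apply]⟩

lemma inner_nonneg_of_mem_pos {x : V} (hx : ∀ j, 0 ≤ ⟪R.α j, x⟫) {a : V} (ha : a ∈ R.pos) :
    0 ≤ ⟪a, x⟫ := by
  obtain ⟨-, c, rfl⟩ := ha
  rw [sum_inner]
  refine Finset.sum_nonneg fun j _ => ?_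
  rw [real_inner_smul_left]
  exact mul_nonneg (Nat.cast_nonneg _) (hx j)

/-- A vector orthogonal to all simple roots vanishes. -/
lemma eq_zero_of_inner_simple {x : V} (hx : ∀ j, ⟪R.α j, x⟫ = 0) : x = 0 := by
  have hr : ∀ a ∈ R.roots, ⟪a, x⟫ = 0 := by
    intro a ha
    rcases R.pos_or_neg a ha with ⟨c, rfl⟩ | ⟨c, rfl⟩ <;>
      simp [sum_inner, real_inner_smul_left, hx]
  have : x ∈ Submodule.span ℝ R.roots := R.span_top ▸ Submodule.mem_top
  have key : ∀ y ∈ Submodule.span ℝ R.roots, ⟪y, x⟫ = 0 := by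
    intro y hy
    induction hy using Submodule.span_induction with
    | mem a ha => exact hr a ha
    | zero => exact inner_zero_left _
    | add y z _ _ hy hz => rw [inner_add_left, hy, hz, add_zero]
    | smul t y _ hy => rw [real_inner_smul_left, hy, mul_zero]
  exact inner_self_eq_zero.1 (key x this)

/-- A simple reflection permutes the positive roots other than its own simple root. -/
lemma sLin_mem_pos {i : Fin r} {b : V} (hb : b ∈ R.pos) (hbi : b ≠ R.α i) :
    sLin (R.α i) b ∈ R.pos := by
  have hroot : sLin (R.α i) b ∈ R.roots := R.reflect_mem _ (R.simple_mem i) b hb.1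
  refine (R.pos_or_neg _ hroot).elim (fun h => ⟨hroot, h⟩) ?_
  rintro ⟨e, he⟩
  exfalso
  obtain ⟨hbr, c, hc⟩ := hb
  rw [sLin_apply] at he
  set m := ⟪coroot (R.α i), b⟫
  have h0 : ∑ j, (((c j : ℝ) + e j) - if j = i then m else 0) • R.α j = 0 := by
    simp only [sub_smul, add_smul, Finset.sum_sub_distrib, Finset.sum_add_distrib, ite_smul,
      zero_smul, Finset.sum_ite_eq', Finset.mem_univ, if_true]
    rw [← hc, ← neg_eq_iff_eq_neg.2 he]
    abel
  have hz := Fintype.linearIndependent_iff.1 R.simple_indep _ h0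
  have hcj : ∀ j, j ≠ i → (c j : ℝ) = 0 := by
    intro j hj
    have := hz j
    simp only [hj, if_false, sub_zero] at this
    exact le_antisymm (by linarith [(Nat.cast_nonneg (e j) : (0 : ℝ) ≤ e j)]) (Nat.cast_nonneg _)
  have hb' : b = (c i : ℝ) • R.α i := by
    rw [hc]
    exact Finset.sum_eq_single i (fun j _ hj => by rw [hcj j hj, zero_smul])
      (fun h => absurd (Finset.mem_univ i) h)
  rcases R.reduced _ (R.simple_mem i) (c i) (hb' ▸ hbr) with h | h
  · exact hbi (by rw [hb', h, one_smul])
  · linarith [(Nat.cast_nonneg (c i) : (0 : ℝ) ≤ c i)]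

variable (R)

/-- The product of simple reflections along a word. -/
def wordMap (l : List (Fin r)) : Module.End ℝ V := (l.map fun i => sLin (R.α i)).prod

variable {R}

@[simp] lemma wordMap_nil (x : V) : R.wordMap [] x = x := rfl

@[simp] lemma wordMap_cons (i : Fin r) (l : List (Fin r)) (x : V) :
    R.wordMap (i :: l) x = sLin (R.α i) (R.wordMap l x) := by
  simp [wordMap]

lemma wordMap_append (l l' : List (Fin r)) (x : V) :
    R.wordMap (l ++ l') x = R.wordMap l (R.wordMap l' x) := by
  simp [wordMap]

lemma exists_wordMap {g : V ≃ₗ[ℝ] V} (hg : g ∈ R.weyl) :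
    ∃ l, ∀ x, g x = R.wordMap l x := by
  rw [weyl] at hg
  induction hg using Subgroup.closure_induction_left with
  | one => exact ⟨[], fun x => rfl⟩
  | mul_left s hs g _ ih =>
    obtain ⟨i, hi⟩ := hs
    obtain ⟨l, hl⟩ := ih
    exact ⟨i :: l, fun x => by rw [LinearEquiv.mul_apply, hi, hl, wordMap_cons]⟩
  | inv_mul_cancel s hs g _ ih =>
    obtain ⟨i, hi⟩ := hs
    obtain ⟨l, hl⟩ := ih
    refine ⟨i :: l, fun x => ?_⟩
    rw [LinearEquiv.mul_apply, wordMap_cons, ← hl]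
    have : s (sLin (R.α i) (g x)) = g x := by rw [hi, sLin_sLin (R.simple_ne_zero i)]
    exact (LinearEquiv.symm_apply_eq s).2 this.symm

lemma inner_wordMap_wordMap (l : List (Fin r)) (x y : V) :
    ⟪R.wordMap l x, R.wordMap l y⟫ = ⟪x, y⟫ := by
  induction l with
  | nil => rfl
  | cons i l ih => rw [wordMap_cons, wordMap_cons, inner_sLin_sLin (R.simple_ne_zero i), ih]

lemma inner_wordMap_left (l : List (Fin r)) (x y : V) :
    ⟪R.wordMap l x, y⟫ = ⟪x, R.wordMap l.reverse y⟫ := by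
  induction l generalizing y with
  | nil => rfl
  | cons i l ih =>
    rw [wordMap_cons, inner_sLin_left, ih, List.reverse_cons, wordMap_append, wordMap_cons,
      wordMap_nil]

lemma wordMap_mem_roots (l : List (Fin r)) {a : V} (ha : a ∈ R.roots) :
    R.wordMap l a ∈ R.roots := by
  induction l with
  | nil => exact ha
  | cons i l ih =>
    rw [wordMap_cons]
    exact R.reflect_mem _ (R.simple_mem i) _ ih

lemma inner_weyl {g : V ≃ₗ[ℝ] V} (hg : g ∈ R.weyl) (x y : V) : ⟪g x, g y⟫ = ⟪x, y⟫ := by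
  obtain ⟨l, hl⟩ := exists_wordMap hg
  rw [hl, hl, inner_wordMap_wordMap]

lemma weyl_mem_roots {g : V ≃ₗ[ℝ] V} (hg : g ∈ R.weyl) {a : V} (ha : a ∈ R.roots) :
    g a ∈ R.roots := by
  obtain ⟨l, hl⟩ := exists_wordMap hg
  rw [hl]
  exact wordMap_mem_roots l ha

/-- The exchange property: if the inverse of a word makes a positive root negative, then
multiplying by the corresponding reflection shortens the word. -/
lemma exists_shorter_word (l : List (Fin r)) {b : V} (hb : b ∈ R.pos)
    (hl : R.wordMap l.reverse b ∉ R.pos) :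
    ∃ l' : List (Fin r), l'.length < l.length ∧
      ∀ x, sLin b (R.wordMap l x) = R.wordMap l' x := by
  induction l generalizing b with
  | nil => exact absurd hb hl
  | cons i l ih =>
    by_cases hbi : b = R.α i
    · exact ⟨l, by simp, fun x => by rw [hbi, wordMap_cons, sLin_sLin (R.simple_ne_zero i)]⟩
    · rw [List.reverse_cons, wordMap_append, wordMap_cons, wordMap_nil] at hl
      obtain ⟨l', hlen, h⟩ := ih (sLin_mem_pos hb hbi) hl
      refine ⟨i :: l', by simpa using hlen, fun x => ?_⟩
      rw [wordMap_cons, wordMap_cons, ← h]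
      conv_lhs => rw [← sLin_sLin (R.simple_ne_zero i) b]
      exact sLin_sLin_conj (R.simple_ne_zero i) _ _

lemma inner_coroot_wordMap_int {μ : V} (hμ : ∀ j, ∃ n : ℤ, ⟪coroot (R.α j), μ⟫ = n)
    (l : List (Fin r)) (j : Fin r) : ∃ n : ℤ, ⟪coroot (R.α j), R.wordMap l μ⟫ = n := by
  induction l generalizing j with
  | nil => exact hμ j
  | cons i l ih =>
    obtain ⟨m, hm⟩ := ih i
    obtain ⟨n, hn⟩ := ih j
    obtain ⟨k, hk⟩ := R.cryst _ (R.simple_mem j) _ (R.simple_mem i)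
    rw [pairc, real_inner_comm] at hk
    refine ⟨n - m * k, ?_⟩
    rw [wordMap_cons, sLin_apply, inner_sub_right, real_inner_smul_right, hm, hn, hk]
    push_cast
    rfl

/-- The crystal of an integral dominant weight contains, up to subdivision, the straight path to
every element of the orbit of the weight. -/
lemma exists_map_smul_wordMap_mem_finCrystalV {μ : V} (hdom : ∀ j, 0 ≤ ⟪R.α j, μ⟫)
    (hint : ∀ j, ∃ n : ℤ, ⟪coroot (R.α j), μ⟫ = n) (l : List (Fin r)) :
    ∃ C : List ℝ, (∀ x ∈ C, 0 ≤ x) ∧ C.sum = 1 ∧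
      C.map (· • R.wordMap l μ) ∈ finCrystalV R μ := by
  induction h : l.length using Nat.strong_induction_on generalizing l with
  | _ k ih =>
    cases l with
    | nil =>
      exact ⟨[1], by simp, by simp, [μ], rfl, by simpa using Relation.ReflTransGen.refl⟩
    | cons i l =>
      subst h
      rcases le_or_gt 0 ⟪coroot (R.α i), R.wordMap l μ⟫ with hi | hi
      · obtain ⟨C, hC, hs, L, hL, hrel⟩ := ih l.length (by simp) l rfl
        obtain ⟨n, hn⟩ := inner_coroot_wordMap_int hint l i
        have hn0 : 0 ≤ n := by rw [hn] at hi; exact_mod_cast hi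
        have hnat : (finOp R i).cov (R.wordMap l μ) = (n.toNat : ℝ) := by
          have : ((n.toNat : ℤ) : ℝ) = n := by rw [Int.toNat_of_nonneg hn0]
          rw [← Int.cast_natCast, this, ← hn]
          rfl
        have hd : (finOp R i).cov (finOp R i).vec = 2 := inner_coroot_self (R.simple_ne_zero i)
        obtain ⟨C', hC', hs', hrel'⟩ :=
          RootOp.exists_reflTransGen_frel_map_s hd n.toNat hnat C hC hs
        refine ⟨C', hC', hs', L, hL, hrel.trans ?_⟩
        have : (finOp R i).s (R.wordMap l μ) = R.wordMap (i :: l) μ := by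
          rw [wordMap_cons, sLin_apply]
          rfl
        rw [← this]
        exact Relation.ReflTransGen.mono (p := fun x y => ∃ i, (finOp R i).frel x y)
          (fun x y hxy => ⟨i, hxy⟩) _ _ hrel'
      · have hneg : R.wordMap l.reverse (R.α i) ∉ R.pos := by
          intro hp
          have h0 := inner_nonneg_of_mem_pos hdom hp
          rw [real_inner_comm, ← inner_wordMap_left, real_inner_comm] at h0
          rw [inner_coroot_left] at hi
          have : 0 ≤ ⟪R.α i, R.α i⟫ := real_inner_self_nonneg
          exact hi.not_ge (by positivity)
        obtain ⟨l', hlen, hl'⟩ := exists_shorter_word l (simple_mem_pos i) hneg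
        rw [wordMap_cons, hl']
        exact ih l'.length (by simp; omega) l' rfl

lemma exists_list_of_mem_corootLattice {v : V} (hv : v ∈ R.corootLattice) :
    ∃ l : List V, (∀ b ∈ l, b ∈ R.roots) ∧ v = (l.map coroot).sum := by
  rw [corootLattice, ← Submodule.mem_toAddSubgroup,
    Submodule.span_int_eq_addSubgroupClosure] at hv
  induction hv using AddSubgroup.closure_induction with
  | mem x hx =>
    obtain ⟨b, hb, rfl⟩ := hx
    exact ⟨[b], by simpa using hb, by simp⟩
  | zero => exact ⟨[], by simp, by simp⟩
  | add x y _ _ hx hy =>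
    obtain ⟨l, hl, rfl⟩ := hx
    obtain ⟨l', hl', rfl⟩ := hy
    refine ⟨l ++ l', fun b hb => ?_, by simp⟩
    rcases List.mem_append.1 hb with hb | hb
    exacts [hl b hb, hl' b hb]
  | neg x _ hx =>
    obtain ⟨l, hl, rfl⟩ := hx
    refine ⟨l.map (- ·), fun b hb => ?_, ?_⟩
    · obtain ⟨a, ha, rfl⟩ := List.mem_map.1 hb
      exact neg_mem_roots (hl a ha)
    · rw [List.sum_neg]
      simp [Function.comp_def, coroot]

lemma inner_sum_coroot_int {a : V} (ha : a ∈ R.roots) (l : List V) (hl : ∀ b ∈ l, b ∈ R.roots) :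
    ∃ n : ℤ, ⟪a, (l.map coroot).sum⟫ = n := by
  induction l with
  | nil => exact ⟨0, by simp⟩
  | cons b l ih =>
    obtain ⟨n, hn⟩ := ih fun x hx => hl x (List.mem_cons_of_mem _ hx)
    obtain ⟨m, hm⟩ := R.cryst b (hl b List.mem_cons_self) a ha
    refine ⟨m + n, ?_⟩
    rw [List.map_cons, List.sum_cons, inner_add_right, hn]
    push_cast
    rw [← hm]
    rfl

lemma inner_int_of_mem_corootLattice {a v : V} (ha : a ∈ R.roots) (hv : v ∈ R.corootLattice) :
    ∃ n : ℤ, ⟪a, v⟫ = n := by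
  obtain ⟨l, hl, rfl⟩ := exists_list_of_mem_corootLattice hv
  exact inner_sum_coroot_int ha l hl

lemma sum_coroot_eq_zero (l : List V) (hl : ∀ b ∈ l, b ∈ R.roots)
    (hle : ∀ a ∈ R.roots, ⟪a, (l.map coroot).sum⟫ ≤ 1) : (l.map coroot).sum = 0 := by
  induction h : l.length generalizing l with
  | zero => simp [List.length_eq_zero_iff.1 h]
  | succ n ih =>
    set v := (l.map coroot).sum with hv
    by_contra hv0
    have hvv : 0 < ⟪v, v⟫ := real_inner_self_pos.2 hv0
    obtain ⟨b, hbl, hb⟩ : ∃ b ∈ l, 0 < ⟪b, v⟫ := by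
      by_contra! hcon
      have hs : ∀ l' : List V, (∀ b ∈ l', ⟪b, v⟫ ≤ 0) → ⟪(l'.map coroot).sum, v⟫ ≤ 0 := by
        intro l' hl'
        induction l' with
        | nil => simp
        | cons b l' ih' =>
          rw [List.map_cons, List.sum_cons, inner_add_left, inner_coroot_left]
          have h1 := ih' fun x hx => hl' x (List.mem_cons_of_mem _ hx)
          have h2 := hl' b List.mem_cons_self
          have h3 : 0 ≤ 2 / ⟪b, b⟫ := div_nonneg zero_le_two real_inner_self_nonneg
          have := mul_nonpos_of_nonneg_of_nonpos h3 h2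
          linarith
      exact (hs l hcon).not_gt hvv
    have hbr := hl b hbl
    have hb1 : ⟪b, v⟫ = 1 := by
      obtain ⟨m, hm⟩ := inner_sum_coroot_int hbr l hl
      have h1 := hle b hbr
      rw [hm] at hb h1 ⊢
      have h2 : 0 < m := by exact_mod_cast hb
      have h3 : m ≤ 1 := by exact_mod_cast h1
      have : m = 1 := by omega
      rw [this, Int.cast_one]
    have hrefl : ((l.erase b).map coroot).sum = sLin b v := by
      have hperm := ((List.perm_cons_erase hbl).map coroot).sum_eq
      rw [List.map_cons, List.sum_cons, ← hv] at hperm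
      rw [sLin_apply, inner_coroot_left, hb1, mul_one, ← coroot, hperm]
      abel
    have hzero := ih (l.erase b) (fun x hx => hl x (List.mem_of_mem_erase hx))
      (fun a ha => by
        rw [hrefl, ← inner_sLin_left]
        exact hle _ (R.reflect_mem b hbr a ha))
      (by rw [List.length_erase_of_mem hbl, h]; rfl)
    rw [hrefl] at hzero
    rw [← sLin_sLin (R.ne_zero b hbr) v, hzero, map_zero] at hv0
    exact hv0 rfl

/-- The only element of the coroot lattice pairing to at most `1` with all roots is `0`. -/
lemma eq_zero_of_mem_corootLattice {v : V} (hv : v ∈ R.corootLattice)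
    (hle : ∀ a ∈ R.roots, ⟪a, v⟫ ≤ 1) : v = 0 := by
  obtain ⟨l, hl, rfl⟩ := exists_list_of_mem_corootLattice hv
  exact sum_coroot_eq_zero l hl hle

/-- The Weyl group moves an integral coweight by elements of the coroot lattice. -/
lemma weyl_sub_mem_corootLattice {c : V} (hc : ∀ j, ∃ n : ℤ, ⟪R.α j, c⟫ = n)
    {g : V ≃ₗ[ℝ] V} (hg : g ∈ R.weyl) : g c - c ∈ R.corootLattice := by
  obtain ⟨l, hl⟩ := exists_wordMap hg
  rw [hl]
  clear hl
  induction l with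
  | nil => simp
  | cons i l ih =>
    obtain ⟨m, hm⟩ := inner_int_of_mem_corootLattice (R.simple_mem i) ih
    obtain ⟨n, hn⟩ := hc i
    have hmn : ⟪R.α i, R.wordMap l c⟫ = ((m + n : ℤ) : ℝ) := by
      rw [inner_sub_right] at hm
      push_cast
      linarith
    have : R.wordMap (i :: l) c - c
        = (R.wordMap l c - c) - (m + n) • coroot (R.α i) := by
      rw [wordMap_cons, sLin_apply, inner_coroot_left, hmn, ← Int.cast_smul_eq_zsmul ℝ (m + n),
        coroot, smul_smul, mul_comm]
      abel
    rw [this]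
    exact sub_mem ih (Submodule.smul_mem _ _
      (Submodule.subset_span ⟨_, R.simple_mem i, rfl⟩))

variable (R)

/-- The closed fundamental alcove, as a subset of `V`. -/
def alcove : Set V := {x | ∀ a ∈ R.pos, 0 ≤ ⟪a, x⟫ ∧ ⟪a, x⟫ ≤ 1}

variable {R}

lemma zero_mem_alcove : (0 : V) ∈ R.alcove := fun a _ => by simp

lemma eq_zero_of_mem_alcove {x : V} (hx : x ∈ R.alcove) (hl : x ∈ R.corootLattice) : x = 0 := by
  refine eq_zero_of_mem_corootLattice hl fun a ha => ?_
  rcases mem_pos_or_neg_mem_pos ha with h | h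
  · exact (hx a h).2
  · have := (hx _ h).1
    rw [inner_neg_left] at this
    linarith

/-- The inverse `x ↦ σ̄⁻¹ x + c` of the chamber automorphism preserves the alcove. -/
lemma inv_smul_add_mem_alcove {c : V} (hmin : R.IsMinusculeCoweight c) {w₀ wi : V ≃ₗ[ℝ] V}
    (hw₀ : R.IsLongest w₀) (hwi : wi ∈ R.weyl) (hwic : wi c = c)
    (hneg : ∀ a ∈ R.pos, ⟪a, c⟫ = 0 → -(wi a) ∈ R.pos) {x : V} (hx : x ∈ R.alcove) :
    (w₀ * wi)⁻¹ x + c ∈ R.alcove := by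
  intro a ha
  have hinv : ⟪a, (w₀ * wi)⁻¹ x⟫ = ⟪w₀ (wi a), x⟫ := by
    rw [← inner_weyl (R.weyl.mul_mem hw₀.1 hwi)]
    have : (w₀ * wi) ((w₀ * wi)⁻¹ x) = x := (w₀ * wi).apply_symm_apply x
    rw [this]
    rfl
  rw [inner_add_right, hinv]
  rcases hmin a ha with h0 | h1
  · have hp := hw₀.2 _ (hneg a ha h0)
    rw [map_neg, neg_neg] at hp
    rw [h0, add_zero]
    exact hx _ hp
  · have hwa : wi a ∈ R.pos := by
      refine (mem_pos_or_neg_mem_pos (weyl_mem_roots hwi ha.1)).resolve_right fun h => ?_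
      have e : ⟪-(wi a), c⟫ = -1 := by
        rw [inner_neg_left, ← h1, ← inner_weyl hwi a c, hwic]
      rcases hmin _ h with h' | h' <;> rw [e] at h' <;> norm_num at h'
    have hp := hx _ (hw₀.2 _ hwa)
    rw [inner_neg_left] at hp
    rw [h1]
    constructor <;> linarith [hp.1, hp.2]

/-- A fundamental weight is a positive multiple of the corresponding coweight. -/
lemma IsFundWeight.exists_eq_smul {i : Fin r} {c ϖ : V} (hϖ : R.IsFundWeight i ϖ)
    (hc : R.IsFundCoweight i c) : ∃ κ : ℝ, 0 < κ ∧ ϖ = κ • c := by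
  have hpos : ∀ j, 0 < ⟪R.α j, R.α j⟫ := fun j => real_inner_self_pos.2 (R.simple_ne_zero j)
  refine ⟨⟪R.α i, R.α i⟫ / 2, half_pos (hpos i), ?_⟩
  refine sub_eq_zero.1 (R.eq_zero_of_inner_simple fun j => ?_)
  have h := hϖ j
  rw [pairc, real_inner_comm, inner_coroot_left] at h
  rw [inner_sub_right, real_inner_smul_right, hc j]
  split_ifs at h ⊢ with hj
  · subst hj
    have := (hpos j).ne'
    field_simp at h
    linarith
  · have := (hpos j).ne'
    simpa [this, R.simple_ne_zero j] using h

/-- `-w₀ ϖ` is dominant if `ϖ` is. -/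
lemma IsLongest.inner_neg_nonneg {w₀ : V ≃ₗ[ℝ] V} (hw₀ : R.IsLongest w₀) {ϖ : V}
    (hϖ : ∀ j, 0 ≤ ⟪R.α j, ϖ⟫) (j : Fin r) : 0 ≤ ⟪R.α j, -(w₀ ϖ)⟫ := by
  have hinv : w₀ (w₀⁻¹ (R.α j)) = R.α j := w₀.apply_symm_apply _
  have hroot : w₀⁻¹ (R.α j) ∈ R.roots := weyl_mem_roots (inv_mem hw₀.1) (R.simple_mem j)
  have e : ⟪R.α j, -(w₀ ϖ)⟫ = ⟪-(w₀⁻¹ (R.α j)), ϖ⟫ := by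
    rw [← inner_weyl hw₀.1 _ ϖ, map_neg, hinv, inner_neg_left, inner_neg_right]
  rw [e]
  rcases mem_pos_or_neg_mem_pos hroot with h | h
  · obtain ⟨c, hc⟩ := (hw₀.2 _ h).2
    obtain ⟨-, d, hd⟩ := simple_mem_pos (R := R) j
    rw [hinv] at hc
    have h0 : ∑ k, ((c k : ℝ) + d k) • R.α k = 0 := by
      simp only [add_smul, Finset.sum_add_distrib]
      rw [← hc, ← hd]
      abel
    have hz := Fintype.linearIndependent_iff.1 R.simple_indep _ h0
    have hd0 : ∀ k, (d k : ℝ) = 0 := fun k => le_antisymm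
      (by linarith [hz k, (Nat.cast_nonneg (c k) : (0 : ℝ) ≤ c k)]) (Nat.cast_nonneg _)
    exact absurd (by rw [hd]; simp [hd0]) (R.simple_ne_zero j)
  · exact inner_nonneg_of_mem_pos hϖ h

end RootSystemBase

/-- **The distinguished dominant path `π_N` of weight 0** (Magyar, Sec. 3.1).  Let
`ϖ∨` be a minuscule fundamental coweight with fundamental weight `ϖ`, `ϖ* = -w₀ ϖ`,
`σ̄ = w₀ w_i` the linear part of the associated chamber automorphism `σ`, and `N` the
order of `σ` (equivalently, the smallest positive integer with `N ϖ∨` in the coroot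
lattice).  Then
`π_N = (σ̄^{-N}(ϖ*) ⋆ ⋯ ⋆ σ̄^{-2}(ϖ*) ⋆ σ̄^{-1}(ϖ*))`
belongs to the `N`-fold concatenation `B(ϖ*) ⋆ ⋯ ⋆ B(ϖ*)` (as a path), is dominant for
the finite root system, and has weight `0`. -/
theorem piN_dominant_weight_zero
    {r : ℕ} (R : RootSystemBase r V)
    (i : Fin r) (c : V) (hc : R.IsFundCoweight i c) (hmin : R.IsMinusculeCoweight c)
    (ϖ : V) (hϖ : R.IsFundWeight i ϖ)
    (w₀ : V ≃ₗ[ℝ] V) (hw₀ : R.IsLongest w₀)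
    (wi : V ≃ₗ[ℝ] V) (hwi : R.IsLongestPar ϖ wi)
    (N : ℕ) (hN0 : 0 < N)
    (hNlat : (N : ℤ) • c ∈ R.corootLattice)
    (hNmin : ∀ k : ℕ, 0 < k → (k : ℤ) • c ∈ R.corootLattice → N ≤ k) :
    letI σbar : V ≃ₗ[ℝ] V := w₀ * wi
    letI ϖstar : V := -(w₀ ϖ)
    letI πN : List V := (List.range N).map fun k => (σbar⁻¹ ^ (N - k)) ϖstar
    (∃ L ∈ catSets (List.replicate N (finCrystalV R ϖstar)),
        normalize L = normalize πN) ∧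
    (∀ j ≤ N, ∀ q : Fin r, 0 ≤ pairc ((πN.take j).sum) (R.α q)) ∧
    πN.sum = 0 := by
  set σbar : V ≃ₗ[ℝ] V := w₀ * wi
  set ϖstar : V := -(w₀ ϖ)
  set πN : List V := (List.range N).map fun k => (σbar⁻¹ ^ (N - k)) ϖstar
  obtain ⟨κ, hκ, hκc⟩ := hϖ.exists_eq_smul hc
  have hdomc : ∀ j, 0 ≤ ⟪R.α j, c⟫ := fun j => by rw [hc j]; split_ifs <;> norm_num
  have hdom : ∀ j, 0 ≤ ⟪R.α j, ϖ⟫ := fun j => by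
    rw [hκc, real_inner_smul_right]; exact mul_nonneg hκ.le (hdomc j)
  have hwic : wi c = c := by
    have := hwi.2.1
    rw [hκc, map_smul] at this
    exact smul_right_injective V hκ.ne' this
  have hneg : ∀ a ∈ R.pos, ⟪a, c⟫ = 0 → -(wi a) ∈ R.pos := fun a ha h0 => by
    refine hwi.2.2 a ha ?_
    rw [pairc, real_inner_comm, inner_coroot_left, hκc, real_inner_smul_right, h0, mul_zero,
      mul_zero]
  have hσ : σbar ∈ R.weyl := R.weyl.mul_mem hw₀.1 hwi.1
  have hgpow : ∀ k : ℕ, σbar⁻¹ ^ k ∈ R.weyl := fun k => pow_mem (inv_mem hσ) k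
  have hstep : ∀ k : ℕ, (σbar⁻¹ ^ (k + 1)) ϖstar = -(κ • (σbar⁻¹ ^ k) c) := by
    intro k
    have h1 : ϖstar = -(κ • σbar c) := by
      change -(w₀ ϖ) = -(κ • w₀ (wi c))
      rw [hwic, hκc, map_smul]
    have h2 : σbar⁻¹ (σbar c) = c := σbar.symm_apply_apply c
    rw [pow_succ, LinearEquiv.mul_apply, h1, map_neg, map_smul, h2, map_neg, map_smul]
  set q : ℕ → V := fun m => ∑ k ∈ Finset.range m, (σbar⁻¹ ^ k) c with hq
  have hqA : ∀ m, q m ∈ R.alcove := by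
    intro m
    induction m with
    | zero => simpa [hq] using RootSystemBase.zero_mem_alcove (R := R)
    | succ m ih =>
      have : q (m + 1) = σbar⁻¹ (q m) + c := by
        simp only [hq, Finset.sum_range_succ', map_sum, pow_zero]
        congr 1
        exact Finset.sum_congr rfl fun k _ => by rw [pow_succ']; rfl
      rw [this]
      exact RootSystemBase.inv_smul_add_mem_alcove hmin hw₀ hwi.1 hwic hneg ih
  have hqN : q N = 0 := by
    refine RootSystemBase.eq_zero_of_mem_alcove (hqA N) ?_
    have : q N = ∑ k ∈ Finset.range N, ((σbar⁻¹ ^ k) c - c) + (N : ℤ) • c := by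
      simp [hq, Finset.sum_sub_distrib]
    rw [this]
    refine add_mem (sum_mem fun k _ => ?_) hNlat
    refine RootSystemBase.weyl_sub_mem_corootLattice (fun j => ?_) (hgpow k)
    exact ⟨if j = i then 1 else 0, by rw [hc j]; split_ifs <;> simp⟩
  have hpart : ∀ j ≤ N, (πN.take j).sum = κ • q (N - j) := by
    intro j
    induction j with
    | zero => intro _; simp [hqN]
    | succ j ih =>
      intro hj
      have hlen : j < πN.length := by simpa [πN] using hj
      rw [List.take_add_one, List.sum_append, ih (by omega), List.getElem?_eq_getElem hlen]
      obtain ⟨m, hm⟩ : ∃ m, N - j = m + 1 := ⟨N - j - 1, by omega⟩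
      have hm' : N - (j + 1) = m := by omega
      have : πN[j] = -(κ • (σbar⁻¹ ^ m) c) := by
        simp only [πN, List.getElem_map, List.getElem_range]
        rw [hm, hstep]
      simp only [this, hm, hm', Option.toList_some, List.sum_singleton]
      simp only [hq, Finset.sum_range_succ, smul_add]
      abel
  refine ⟨?_, ?_, ?_⟩
  · have hlen : πN.length = N := by simp [πN]
    have hint : ∀ j, ∃ n : ℤ, ⟪coroot (R.α j), ϖstar⟫ = n := by
      intro j
      obtain ⟨l, hl⟩ := RootSystemBase.exists_wordMap hw₀.1
      obtain ⟨n, hn⟩ := RootSystemBase.inner_coroot_wordMap_int (R := R) (μ := ϖ) (fun j =>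
        ⟨if j = i then 1 else 0, by
          rw [real_inner_comm, ← pairc, hϖ j]; split_ifs <;> simp⟩) l j
      refine ⟨-n, ?_⟩
      change ⟪coroot (R.α j), -(w₀ ϖ)⟫ = _
      rw [inner_neg_right, hl, hn]
      push_cast
      rfl
    have := exists_mem_catSets_normalize_eq (finCrystalV R ϖstar) πN fun v hv => by
      obtain ⟨k, -, rfl⟩ := List.mem_map.1 hv
      obtain ⟨l, hl⟩ := RootSystemBase.exists_wordMap (hgpow (N - k))
      rw [hl]
      exact RootSystemBase.exists_map_smul_wordMap_mem_finCrystalV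
        (hw₀.inner_neg_nonneg hdom) hint l
    rwa [hlen] at this
  · intro j hj p
    rw [hpart j hj, pairc, real_inner_comm, inner_coroot_left, real_inner_smul_right]
    have h1 := (hqA (N - j) _ (RootSystemBase.simple_mem_pos p)).1
    have h2 : 0 ≤ ⟪R.α p, R.α p⟫ := real_inner_self_nonneg
    positivity
  · have h := hpart N le_rfl
    rw [List.take_of_length_le (by simp [πN])] at h
    rw [h]
    simp [hq]

end Litt
end
end

section
/- Let R be a ring and let V₁ and V₂ be semisimple R-modules of finite length. If φ : V₁ → V₂ and ψ : V₁ → V₂ are two injective R-module homomorphisms, then there exist R-module automorphisms ξ₁ of V₁ and ξ₂ of V₂ such that ψ ∘ ξ₁ = ξ₂ ∘ φ (i.e. the square with φ on top, ψ on bottom, ξ₁ and ξ₂ vertical, commutes). -/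
section

variable {R M N : Type*} [Ring R] [AddCommGroup M] [Module R M] [AddCommGroup N] [Module R N]

/-- A linear map out of a semisimple module has a section over its range. -/
theorem IsSemisimpleModule.exists_section_range [IsSemisimpleModule R M] (f : M →ₗ[R] N) :
    ∃ s : LinearMap.range f →ₗ[R] M, ∀ y, f (s y) = y := by
  obtain ⟨C, hC⟩ := exists_isCompl (LinearMap.ker f)
  refine ⟨C.subtype ∘ₗ (f.kerComplementEquivRange hC.symm).symm.toLinearMap, fun y ↦ ?_⟩
  obtain ⟨c, rfl⟩ := (f.kerComplementEquivRange hC.symm).surjective y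
  simp

/-- A noetherian semisimple endomorphism is injective as soon as every homomorphism from its
kernel to the module takes values in its range. -/
theorem Module.End.injective_of_forall_range_le [IsSemisimpleModule R M] [IsNoetherian R M]
    (f : Module.End R M)
    (h : ∀ u : LinearMap.ker f →ₗ[R] M, LinearMap.range u ≤ LinearMap.range f) :
    Function.Injective f := by
  obtain ⟨s, hs⟩ := IsSemisimpleModule.exists_section_range f
  have key (n : ℕ) : ∀ u : LinearMap.ker f →ₗ[R] M, ∃ v : LinearMap.ker f →ₗ[R] M,
      ∀ x, (f ^ n) (v x) = u x := by
    induction n with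
    | zero => exact fun u ↦ ⟨u, fun x ↦ rfl⟩
    | succ n ih =>
      intro u
      obtain ⟨v, hv⟩ := ih u
      refine ⟨s ∘ₗ v.codRestrict _ fun x ↦ h v ⟨x, rfl⟩, fun x ↦ ?_⟩
      simp [pow_succ, hs, hv]
  obtain ⟨n, hn, hn₁⟩ := (f.eventually_disjoint_ker_pow_range_pow.and
    (Filter.eventually_ge_atTop 1)).exists
  rw [← LinearMap.ker_eq_bot, eq_bot_iff]
  intro x hx
  obtain ⟨v, hv⟩ := key n (LinearMap.ker f).subtype
  refine (Submodule.disjoint_def.mp hn) x ?_ ⟨v ⟨x, hx⟩, hv ⟨x, hx⟩⟩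
  obtain ⟨m, rfl⟩ := Nat.exists_eq_add_of_le' hn₁
  rw [LinearMap.mem_ker] at hx ⊢
  simp [pow_succ, hx]

/-- In an artinian and noetherian semisimple module, an embedding of a submodule extends to an
automorphism of the whole module. -/
theorem IsSemisimpleModule.exists_linearEquiv_extending [IsSemisimpleModule R M]
    [IsNoetherian R M] [IsArtinian R M] (A : Submodule R M) (g : A →ₗ[R] M)
    (hg : Function.Injective g) : ∃ e : M ≃ₗ[R] M, ∀ a : A, e a = g a := by
  let E : Set (Module.End R M) := {f | ∀ a : A, f a = g a}
  have hE : E.Nonempty := by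
    obtain ⟨f, hf⟩ := LinearMap.surjective_comp_subtype_of_isComplemented
      (exists_isCompl A) g
    exact ⟨f, fun a ↦ LinearMap.congr_fun hf a⟩
  obtain ⟨f, hf, hmin⟩ := WellFounded.has_min
    (InvImage.wf (LinearMap.ker : Module.End R M → Submodule R M) wellFounded_lt) E hE
  have hinj : Function.Injective f := by
    refine Module.End.injective_of_forall_range_le f fun u ↦ ?_
    have hdisj : Disjoint A (LinearMap.ker f) := by
      refine Submodule.disjoint_def.mpr fun x hxA hx ↦ ?_
      have : g ⟨x, hxA⟩ = 0 := (hf ⟨x, hxA⟩).symm.trans hx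
      simpa using (map_eq_zero_iff g hg).mp this
    obtain ⟨B, hAB, hB⟩ := hdisj.exists_isCompl
    obtain ⟨D, hD⟩ := exists_isCompl (LinearMap.range f)
    let q := D.projection _ hD.symm
    let p := (LinearMap.ker f).projectionOnto B hB.symm
    let f' : Module.End R M := f + q ∘ₗ u ∘ₗ p
    have hf' : f' ∈ E := fun a ↦ by
      simp [f', p, Submodule.projectionOnto_apply_of_mem_right _ (hAB a.2), hf a]
    have hker {x : M} (hx : f' x = 0) : f x = 0 ∧ q (u (p x)) = 0 := by
      have hx' : f x + q (u (p x)) = 0 := hx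
      have hfx : f x = 0 := Submodule.disjoint_def.mp hD.disjoint _ ⟨x, rfl⟩ <| by
        rw [eq_neg_of_add_eq_zero_left hx']
        exact D.neg_mem (Submodule.projection_apply_mem _ _)
      exact ⟨hfx, by simpa [hfx] using hx'⟩
    have hle : LinearMap.ker f' ≤ LinearMap.ker f := fun x hx ↦ (hker hx).1
    have heq := hle.eq_of_not_lt (hmin f' hf')
    rintro _ ⟨x, rfl⟩
    have hx := (hker (show f' x = 0 from heq.ge x.2)).2
    rw [Submodule.projectionOnto_apply_left] at hx
    exact (Submodule.projection_apply_eq_zero_iff _).mp hx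
  exact ⟨.ofBijective f (IsArtinian.bijective_of_injective_endomorphism f hinj), hf⟩

end

/-- **Complete-reducibility lemma** (Magyar, Sec. 3.1).  If `V₁`, `V₂` are semisimple
modules of finite length over a ring `R` and `φ, ψ : V₁ ↪ V₂` are two injective
`R`-module homomorphisms, then there are automorphisms `ξ₁` of `V₁` and `ξ₂` of `V₂`
making the square commute: `ψ ∘ ξ₁ = ξ₂ ∘ φ`. -/
theorem exists_automorphisms_comm_of_injective
    (R : Type*) [Ring R] (V₁ V₂ : Type*)
    [AddCommGroup V₁] [Module R V₁] [AddCommGroup V₂] [Module R V₂]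
    [IsSemisimpleModule R V₁] [IsSemisimpleModule R V₂]
    (h₁ : IsFiniteLength R V₁) (h₂ : IsFiniteLength R V₂)
    (φ ψ : V₁ →ₗ[R] V₂) (hφ : Function.Injective φ) (hψ : Function.Injective ψ) :
    ∃ (ξ₁ : V₁ ≃ₗ[R] V₁) (ξ₂ : V₂ ≃ₗ[R] V₂),
      ψ.comp (ξ₁ : V₁ →ₗ[R] V₁) = (ξ₂ : V₂ →ₗ[R] V₂).comp φ := by
  obtain ⟨_, _⟩ := isFiniteLength_iff_isNoetherian_isArtinian.mp h₂
  let i := LinearEquiv.ofInjective φ hφ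
  obtain ⟨e, he⟩ := IsSemisimpleModule.exists_linearEquiv_extending (LinearMap.range φ)
    (ψ ∘ₗ i.symm.toLinearMap) (hψ.comp i.symm.injective)
  refine ⟨.refl R V₁, e, LinearMap.ext fun x ↦ ?_⟩
  simpa [i] using (he (i x)).symm
end
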